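/- Let A = KQ/I be a finite-dimensional algebra over an algebraically closed field K, where Q is a finite quiver and I is an admissible ideal of KQ, and assume A is geometrically irreducible. If M and N are rigid finite-dimensional A-modules (i.e. Ext^1_A(M,M) = 0 and Ext^1_A(N,N) = 0) with the same dimension vector, then M and N are isomorphic. -/

import Mathlib

open scoped BigOperators

noncomputable section
/-! ## Quivers and paths -/

/-- A finite quiver: finite sets of vertices and arrows together with source and
target maps. -/
structure FinQuiver : Type 1 where
  V : Type
  A : Type
  [fintypeV : Fintype V]
  [fintypeA : Fintype A]
  [decEqV : DecidableEq V]
  [decEqA : DecidableEq A]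
  src : A → V
  tgt : A → V

attribute [instance] FinQuiver.fintypeV FinQuiver.fintypeA FinQuiver.decEqV FinQuiver.decEqA

/-- A path of positive length in a quiver: a list of composable arrows `[a₁, …, aₘ]`
satisfying `s (aᵢ) = t (aᵢ₊₁)`. -/
structure QPath (Q : FinQuiver) : Type where
  arrows : List Q.A
  ne : arrows ≠ []
  chain : arrows.Chain' fun a b => Q.src a = Q.tgt b

namespace QPath

variable {Q : FinQuiver}

/-- The length of a path. -/
def length (p : QPath Q) : ℕ := p.arrows.length

/-- The target `t (a₁)` of a path `(a₁, …, aₘ)`. -/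
def tgt (p : QPath Q) : Q.V := Q.tgt (p.arrows.head p.ne)

/-- The source `s (aₘ)` of a path `(a₁, …, aₘ)`. -/
def src (p : QPath Q) : Q.V := Q.src (p.arrows.getLast p.ne)

/-- A path is a cycle if its source equals its target. -/
def IsCycle (p : QPath Q) : Prop := p.src = p.tgt

/-- A cycle `(a₁, …, aₘ)` is primitive if the vertices `s (a₁), …, s (aₘ)` are pairwise
different. -/
def IsPrimitive (p : QPath Q) : Prop := (p.arrows.map Q.src).Nodup

end QPath

/-! ## The path algebra, relations, admissible ideals and representation varieties -/

/-- The defining relations presenting the path algebra `KQ` as a quotient of the free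
algebra on the vertices and arrows of `Q`: the vertices become a complete set of
orthogonal idempotents summing to `1`, and `e_{t(a)} * a = a = a * e_{s(a)}` for every
arrow `a`. -/
inductive PathRel (K : Type) [Field K] (Q : FinQuiver) :
    FreeAlgebra K (Q.V ⊕ Q.A) → FreeAlgebra K (Q.V ⊕ Q.A) → Prop
  | idem (i : Q.V) : PathRel K Q
      (FreeAlgebra.ι K (Sum.inl i) * FreeAlgebra.ι K (Sum.inl i)) (FreeAlgebra.ι K (Sum.inl i))
  | orth (i j : Q.V) (h : i ≠ j) : PathRel K Q
      (FreeAlgebra.ι K (Sum.inl i) * FreeAlgebra.ι K (Sum.inl j)) 0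
  | sum_one : PathRel K Q (∑ i : Q.V, FreeAlgebra.ι K (Sum.inl i)) 1
  | tgt_mul (a : Q.A) : PathRel K Q
      (FreeAlgebra.ι K (Sum.inl (Q.tgt a)) * FreeAlgebra.ι K (Sum.inr a))
      (FreeAlgebra.ι K (Sum.inr a))
  | mul_src (a : Q.A) : PathRel K Q
      (FreeAlgebra.ι K (Sum.inr a) * FreeAlgebra.ι K (Sum.inl (Q.src a)))
      (FreeAlgebra.ι K (Sum.inr a))

/-- The path algebra `KQ`. -/
abbrev PathAlgebra (K : Type) [Field K] (Q : FinQuiver) : Type := RingQuot (PathRel K Q)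

variable (K : Type) [Field K] (Q : FinQuiver)

/-- The idempotent `eᵢ ∈ KQ` corresponding to a vertex `i` (the path of length zero
at `i`). -/
def vertexElem (i : Q.V) : PathAlgebra K Q :=
  RingQuot.mkAlgHom K (PathRel K Q) (FreeAlgebra.ι K (Sum.inl i))

/-- The element of `KQ` corresponding to an arrow `a`. -/
def arrowElem (a : Q.A) : PathAlgebra K Q :=
  RingQuot.mkAlgHom K (PathRel K Q) (FreeAlgebra.ι K (Sum.inr a))

/-- The element of `KQ` corresponding to a path `(a₁, …, aₘ)`, namely `a₁ ⋯ aₘ`. -/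
def pathElem (p : QPath Q) : PathAlgebra K Q := (p.arrows.map (arrowElem K Q)).prod

/-- The element `∑ₚ c p • p` of `KQ` determined by a finitely supported family of
coefficients on paths. -/
def relElem (c : QPath Q →₀ K) : PathAlgebra K Q := c.sum fun p l => l • pathElem K Q p

/-- `c` is the datum of a relation with common target `i` and common source `j`: all
paths in its support have length at least two, target `i` and source `j`.  (The paths in
the support are pairwise different and have nonzero coefficients by definition of a
finitely supported function.) -/
def IsRelationData (c : QPath Q →₀ K) (i j : Q.V) : Prop :=
  ∀ p ∈ c.support, 2 ≤ p.length ∧ p.tgt = i ∧ p.src = j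

/-- An element of `KQ` is a relation if it is a `K`-linear combination `∑ λₚ • p` of
pairwise different paths of length at least two having a common source and a common
target, with all `λₚ ≠ 0`. -/
def IsRelation (x : PathAlgebra K Q) : Prop :=
  ∃ (c : QPath Q →₀ K) (i j : Q.V), IsRelationData K Q c i j ∧ x = relElem K Q c

/-- The two-sided ideal generated by a set `S`, as a set: the additive subgroup generated
by all elements `a * s * b` with `s ∈ S`. -/
def twoSidedSpan (R : Type) [Ring R] (S : Set R) : Set R :=
  (AddSubgroup.closure {x | ∃ a b : R, ∃ s ∈ S, x = a * s * b} : AddSubgroup R)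

/-- `φ : KQ →ₐ[K] A` presents `A` as `KQ/I` with `I = ker φ` an admissible ideal:
`φ` is surjective, its kernel is generated (as a two-sided ideal) by a set of relations,
and there is some `m ≥ 2` such that all paths of length at least `m` lie in the kernel. -/
def IsAdmissiblePresentation {A : Type} [Ring A] [Algebra K A]
    (φ : PathAlgebra K Q →ₐ[K] A) : Prop :=
  Function.Surjective φ ∧
  (∃ S : Set (PathAlgebra K Q), (∀ x ∈ S, IsRelation K Q x) ∧
    twoSidedSpan (PathAlgebra K Q) S = {x | φ x = 0}) ∧
  ∃ m : ℕ, 2 ≤ m ∧ ∀ p : QPath Q, m ≤ p.length → φ (pathElem K Q p) = 0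

/-- The index type for the rows/columns of the matrices in a `d`-dimensional
representation: the basis vectors of `⊕ᵢ K^{dᵢ}`. -/
abbrev RepIx (d : Q.V → ℕ) : Type := (i : Q.V) × Fin (d i)

/-- The ambient affine space of `d`-dimensional representations.  An arrow `a` gets a
matrix; membership in `RepSet` forces the matrix of `a` to be concentrated in the block
with rows indexed by the block `t(a)` and columns indexed by the block `s(a)`, i.e. to be
(the block extension of) a `d (t a) × d (s a)`-matrix. -/
abbrev RepSpace (d : Q.V → ℕ) : Type := Q.A → Matrix (RepIx Q d) (RepIx Q d) K

/-- The Zariski topology on affine space `K^ι`: generated by the complements of zero sets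
of polynomials in the coordinates. -/
def zariskiTopology (ι R : Type) [CommSemiring R] : TopologicalSpace (ι → R) :=
  TopologicalSpace.generateFrom
    {U | ∃ f : MvPolynomial ι R, U = {x | MvPolynomial.eval x f ≠ 0}}

/-- The Zariski topology on the ambient space of `d`-dimensional representations. -/
def repTopology (d : Q.V → ℕ) : TopologicalSpace (RepSpace K Q d) :=
  TopologicalSpace.induced (fun M (x : Q.A × RepIx Q d × RepIx Q d) => M x.1 x.2.1 x.2.2)
    (zariskiTopology (Q.A × RepIx Q d × RepIx Q d) K)

/-- The condition that the matrix of each arrow `a` is concentrated in the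
`(t a, s a)`-block, i.e. really is a `d (t a) × d (s a)`-matrix. -/
def BlockCompatible (d : Q.V → ℕ) (M : RepSpace K Q d) : Prop :=
  ∀ (a : Q.A) (u v : RepIx Q d), M a u v ≠ 0 → u.1 = Q.tgt a ∧ v.1 = Q.src a

/-- The evaluation `M(p) = M(a₁) ⋯ M(aₘ)` of a representation at a path. -/
def pathProd (d : Q.V → ℕ) (M : RepSpace K Q d) (p : QPath Q) :
    Matrix (RepIx Q d) (RepIx Q d) K := (p.arrows.map M).prod

/-- The evaluation `M(ρ) = ∑ λₚ M(p)` of a representation at a linear combination of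
paths. -/
def relEval (d : Q.V → ℕ) (M : RepSpace K Q d) (c : QPath Q →₀ K) :
    Matrix (RepIx Q d) (RepIx Q d) K := c.sum fun p l => l • pathProd K Q d M p

/-- The affine variety `rep(A, d)` of `d`-dimensional representations of `A = KQ/I`,
where `I = ker φ`: tuples of matrices (of the correct block sizes) with `M(ρ) = 0` for
every relation `ρ ∈ I`. -/
def RepSet {A : Type} [Ring A] [Algebra K A] (φ : PathAlgebra K Q →ₐ[K] A) (d : Q.V → ℕ) :
    Set (RepSpace K Q d) :=
  {M | BlockCompatible K Q d M ∧
    ∀ (c : QPath Q →₀ K) (i j : Q.V), IsRelationData K Q c i j →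
      φ (relElem K Q c) = 0 → relEval K Q d M c = 0}

/-- `A = KQ/I` (presented by `φ`, with `I = ker φ`) is geometrically irreducible if
`rep(A, d)` is an irreducible topological space for every dimension vector `d`. -/
def IsGeomIrreducible {A : Type} [Ring A] [Algebra K A] (φ : PathAlgebra K Q →ₐ[K] A) :
    Prop :=
  ∀ d : Q.V → ℕ, @IsIrreducible _ (repTopology K Q d) (RepSet K Q φ d)

/-! ## Rigid modules -/

/-- `Ext¹_A(M, M) = 0`, phrased elementarily: every short exact sequence
`0 → M → E → M → 0` splits. -/
def RigidModule (A : Type) [Ring A] (M : Type) [AddCommGroup M] [Module A M] : Prop :=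
  ∀ (E : Type) [AddCommGroup E] [Module A E], ∀ (f : M →ₗ[A] E) (g : E →ₗ[A] M),
    Function.Injective f → Function.Surjective g → LinearMap.range f = LinearMap.ker g →
    ∃ s : M →ₗ[A] E, g.comp s = LinearMap.id

/-! ## The dimension vector of a module -/

/-- Multiplication by an element `a : A` as a `K`-linear endomorphism of an
`A`-module. -/
def actionMap (A : Type) [Ring A] [Algebra K A] (M : Type) [AddCommGroup M]
    [Module K M] [Module A M] [IsScalarTower K A M] (a : A) : M →ₗ[K] M where
  toFun m := a • m
  map_add' m n := smul_add a m n
  map_smul' k m := by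
    simp only [RingHom.id_apply]
    exact smul_algebra_smul_comm k a m

/-- The dimension vector of an `A = KQ/I`-module `M` : the function
`i ↦ dim_K (eᵢ M)`. -/
def dimVec {A : Type} [Ring A] [Algebra K A] (φ : PathAlgebra K Q →ₐ[K] A)
    (M : Type) [AddCommGroup M] [Module K M] [Module A M] [IsScalarTower K A M] :
    Q.V → ℕ :=
  fun i => Module.finrank K ↥(LinearMap.range (actionMap K A M (φ (vertexElem K Q i))))

section GeometricIrreducibility

open Matrix Polynomial

theorem LinearMap.exists_comp_comp_eq_self {F V W : Type*} [Field F] [AddCommGroup V] [Module F V]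
    [AddCommGroup W] [Module F W] (f : V →ₗ[F] W) : ∃ g : W →ₗ[F] V, ∀ v, f (g (f v)) = f v := by
  obtain ⟨s, hs⟩ := f.rangeRestrict.exists_rightInverse_of_surjective f.range_rangeRestrict
  obtain ⟨g, hg⟩ := s.exists_extend
  refine ⟨g, fun v => ?_⟩
  have h₁ : g (f v) = s (f.rangeRestrict v) := LinearMap.congr_fun hg (f.rangeRestrict v)
  rw [h₁]
  exact congrArg Subtype.val (LinearMap.congr_fun hs (f.rangeRestrict v))

theorem Matrix.exists_mul_add_mul_eq_one {F V W U : Type*} [Field F] [Fintype V] [Fintype W]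
    [Fintype U] [DecidableEq V] [DecidableEq W] [DecidableEq U]
    (A : Matrix W V F) (B : Matrix U W F)
    (h : ∀ w, B *ᵥ w = 0 → ∃ v, A *ᵥ v = w) :
    ∃ (S : Matrix V W F) (T : Matrix W U F), A * S + T * B = 1 := by
  obtain ⟨a, ha⟩ := (Matrix.toLin' A).exists_comp_comp_eq_self
  obtain ⟨b, hb⟩ := (Matrix.toLin' B).exists_comp_comp_eq_self
  refine ⟨LinearMap.toMatrix' a * (1 - LinearMap.toMatrix' b * B), LinearMap.toMatrix' b, ?_⟩
  apply Matrix.toLin'.injective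
  refine LinearMap.ext fun w => ?_
  simp only [Matrix.toLin'_apply] at ha hb
  obtain ⟨v, hv⟩ := h (w - b (B *ᵥ w)) (by rw [Matrix.mulVec_sub, hb, sub_self])
  have key : A *ᵥ a (w - b (B *ᵥ w)) = w - b (B *ᵥ w) := by rw [← hv, ha]
  simp only [Matrix.toLin'_apply, Matrix.add_mulVec, Matrix.sub_mulVec,
    ← Matrix.mulVec_mulVec, LinearMap.toMatrix'_mulVec, Matrix.one_mulVec]
  rw [key, sub_add_cancel]

theorem LinearMap.exists_finset_forall_eq_zero {F W U ι : Type*} [Field F] [AddCommGroup W]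
    [Module F W] [Module.Finite F W] [AddCommGroup U] [Module F U] (L : ι → W →ₗ[F] U)
    (J : Set ι) : ∃ t : Finset ι, ↑t ⊆ J ∧
      ∀ w, (∀ r ∈ t, L r w = 0) → ∀ r ∈ J, L r w = 0 := by
  classical
  obtain ⟨_, ⟨t, ht, rfl⟩, hmin⟩ := IsArtinian.set_has_minimal (R := F) (M := W)
    {p | ∃ t : Finset ι, ↑t ⊆ J ∧ p = t.inf fun r => LinearMap.ker (L r)}
    ⟨_, ∅, by simp, rfl⟩
  refine ⟨t, ht, fun w hw r hr => ?_⟩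
  have hle : (insert r t).inf (fun r => LinearMap.ker (L r)) ≤ t.inf fun r => LinearMap.ker (L r) :=
    Finset.inf_mono (Finset.subset_insert r t)
  have heq := hle.eq_of_not_lt (hmin _ ⟨insert r t, by
    simpa [Set.insert_subset_iff] using ⟨hr, ht⟩, rfl⟩)
  have hmem : w ∈ (insert r t).inf fun r => LinearMap.ker (L r) := by
    rw [heq]
    simpa [Submodule.mem_finsetInf] using hw
  exact (Submodule.mem_finsetInf.1 hmem) r (Finset.mem_insert_self r t)

theorem Matrix.aeval_mul_eq_mul_aeval {R V W : Type*} [CommRing R] [Fintype V] [Fintype W]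
    [DecidableEq V] [DecidableEq W] {A : Matrix W V R} {P : Matrix W W R} {Q : Matrix V V R}
    (h : P * A = A * Q) (p : R[X]) : aeval P p * A = A * aeval Q p := by
  induction p using Polynomial.induction_on' with
  | add p q hp hq => simp [Matrix.add_mul, Matrix.mul_add, hp, hq]
  | monomial n a =>
    have hn : ∀ n : ℕ, P ^ n * A = A * Q ^ n := by
      intro n
      induction n with
      | zero => simp
      | succ n ih => rw [pow_succ, pow_succ, Matrix.mul_assoc, h, ← Matrix.mul_assoc, ih,
          Matrix.mul_assoc]
    simp [aeval_monomial, ← Algebra.smul_def, hn]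

theorem Matrix.map_aeval_charpoly {R R' V W : Type*} [CommRing R] [CommRing R'] [Fintype V] [Fintype W]
    [DecidableEq V] [DecidableEq W] (e : R →+* R') (P : Matrix W W R) (Q : Matrix V V R) :
    (aeval Q P.charpoly).map e = aeval (Q.map e) (P.map e).charpoly := by
  rw [Matrix.charpoly_map]
  have := Polynomial.map_aeval_eq_aeval_map (φ := e) (ψ := e.mapMatrix (m := V)) (by
    ext r i j
    by_cases hij : i = j <;> simp [Matrix.algebraMap_matrix_apply, hij]) P.charpoly Q
  simpa using this

/-- A kernel vector of a matrix which is exact at a point deforms to a kernel vector at all points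
over which the sequence is still a complex. -/
theorem Matrix.exists_deformation_of_mulVec_eq_zero {F R V W U : Type*} [Field F] [CommRing R]
    [Algebra F R] [Fintype V] [Fintype W] [Fintype U] [DecidableEq V] [DecidableEq W]
    [DecidableEq U] (A : Matrix W V R) (B : Matrix U W R) (e₀ : R →ₐ[F] F)
    (hexact : ∀ w, B.map e₀ *ᵥ w = 0 → ∃ v, A.map e₀ *ᵥ v = w)
    (v₀ : V → F) (hv₀ : A.map e₀ *ᵥ v₀ = 0) :
    ∃ u : V → R, (∃ c : F, c ≠ 0 ∧ e₀ ∘ u = c • v₀) ∧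
      ∀ e : R →ₐ[F] F, B.map e * A.map e = 0 → A.map e *ᵥ (e ∘ u) = 0 := by
  obtain ⟨S, T, hST⟩ := Matrix.exists_mul_add_mul_eq_one _ _ hexact
  set S' := S.map (algebraMap F R) with hS'
  set T' := T.map (algebraMap F R) with hT'
  have hS : ∀ e : R →ₐ[F] F, S'.map e = S := fun e => by ext; simp [hS']
  have hT : ∀ e : R →ₐ[F] F, T'.map e = T := fun e => by ext; simp [hT']
  have hP : ∀ e : R →ₐ[F] F, (A * S' + T' * B).map e = A.map e * S + T * B.map e := fun e => by
    rw [Matrix.map_add _ (map_add e), Matrix.map_mul, Matrix.map_mul, hS, hT]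
  have hu : ∀ e : R →ₐ[F] F,
      e ∘ (aeval (S' * A) (A * S' + T' * B).charpoly *ᵥ (algebraMap F R ∘ v₀)) =
        aeval (S * A.map e) (A.map e * S + T * B.map e).charpoly *ᵥ v₀ := fun e => by
    have h := Matrix.map_aeval_charpoly (e : R →+* F) (A * S' + T' * B) (S' * A)
    simp only [AlgHom.coe_toRingHom, hP, Matrix.map_mul, hS] at h
    rw [← h]
    ext i
    have := RingHom.map_mulVec (e : R →+* F)
      (aeval (S' * A) (A * S' + T' * B).charpoly) (algebraMap F R ∘ v₀) i
    simpa [Function.comp_def] using this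
  refine ⟨aeval (S' * A) (A * S' + T' * B).charpoly *ᵥ (algebraMap F R ∘ v₀),
    ⟨(-1) ^ Fintype.card W, by simp, ?_⟩, fun e he => ?_⟩
  · rw [hu, hST, Matrix.charpoly_one]
    have h : ∀ n : ℕ, (S * A.map e₀ - 1) ^ n *ᵥ v₀ = (-1 : F) ^ n • v₀ := by
      intro n
      induction n with
      | zero => simp
      | succ n ih =>
        rw [pow_succ, ← Matrix.mulVec_mulVec, Matrix.sub_mulVec, ← Matrix.mulVec_mulVec, hv₀]
        simp [Matrix.mulVec_neg, ih, pow_succ]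
    simpa using h (Fintype.card W)
  · rw [hu, Matrix.mulVec_mulVec, ← Matrix.aeval_mul_eq_mul_aeval (P := A.map e * S + T * B.map e),
      Matrix.aeval_self_charpoly, Matrix.zero_mul, Matrix.zero_mulVec]
    rw [Matrix.add_mul, Matrix.mul_assoc T, he, Matrix.mul_zero, add_zero, Matrix.mul_assoc]

/-- The algebra homomorphism from a free algebra to block upper triangular matrices with diagonal
blocks given by `X` and `Y` and upper right block given by `D` on the generators. -/
def triangularHom (F : Type*) {R G n : Type*} [CommSemiring F] [CommRing R] [Algebra F R]
    [Fintype n] [DecidableEq n] (X Y D : G → Matrix n n R) :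
    FreeAlgebra F G →ₐ[F] Matrix (n ⊕ n) (n ⊕ n) R :=
  FreeAlgebra.lift F fun g => Matrix.fromBlocks (X g) (D g) 0 (Y g)

/-- The value at an element of the free algebra of the `(X, Y)`-derivation given by `D` on the
generators. -/
def corner (F : Type*) {R G n : Type*} [CommSemiring F] [CommRing R] [Algebra F R]
    [Fintype n] [DecidableEq n] (X Y D : G → Matrix n n R) (r : FreeAlgebra F G) : Matrix n n R :=
  (triangularHom F X Y D r).toBlocks₁₂

section Corner

variable {F R G n : Type*} [CommSemiring F] [CommRing R] [Algebra F R] [Fintype n] [DecidableEq n]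
  (X Y D : G → Matrix n n R)

theorem triangularHom_eq_fromBlocks (r : FreeAlgebra F G) :
    triangularHom F X Y D r = Matrix.fromBlocks (FreeAlgebra.lift F X r) (corner F X Y D r) 0
      (FreeAlgebra.lift F Y r) := by
  have key : (triangularHom F X Y D r).toBlocks₁₁ = FreeAlgebra.lift F X r ∧
      (triangularHom F X Y D r).toBlocks₂₁ = 0 ∧
      (triangularHom F X Y D r).toBlocks₂₂ = FreeAlgebra.lift F Y r := by
    induction r using FreeAlgebra.induction with
    | grade0 c =>
      have h : triangularHom F X Y D (algebraMap F _ c) =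
          Matrix.fromBlocks (algebraMap F _ c) 0 0 (algebraMap F _ c) := by
        rw [AlgHom.commutes, Algebra.algebraMap_eq_smul_one, ← Matrix.fromBlocks_one,
          Matrix.fromBlocks_smul]
        simp [Algebra.algebraMap_eq_smul_one]
      rw [h]
      simp
    | grade1 g => simp [triangularHom]
    | add a b ha hb =>
      rw [← Matrix.fromBlocks_toBlocks (triangularHom F X Y D a)] at ha
      rw [← Matrix.fromBlocks_toBlocks (triangularHom F X Y D b)] at hb
      rw [map_add, ← Matrix.fromBlocks_toBlocks (triangularHom F X Y D a),
        ← Matrix.fromBlocks_toBlocks (triangularHom F X Y D b), Matrix.fromBlocks_add]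
      simp_all
    | mul a b ha hb =>
      rw [map_mul, ← Matrix.fromBlocks_toBlocks (triangularHom F X Y D a),
        ← Matrix.fromBlocks_toBlocks (triangularHom F X Y D b), Matrix.fromBlocks_multiply]
      simp [ha, hb]
  rw [corner, ← key.1, ← key.2.1, ← key.2.2, Matrix.fromBlocks_toBlocks]

theorem corner_algebraMap (c : F) : corner F X Y D (algebraMap F _ c) = 0 := by
  rw [corner, AlgHom.commutes, Algebra.algebraMap_eq_smul_one, ← Matrix.fromBlocks_one,
    Matrix.fromBlocks_smul]
  simp

theorem corner_ι (g : G) : corner F X Y D (FreeAlgebra.ι F g) = D g := by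
  simp [corner, triangularHom]

theorem corner_add (a b : FreeAlgebra F G) :
    corner F X Y D (a + b) = corner F X Y D a + corner F X Y D b := by
  rw [corner, map_add]
  rfl

theorem corner_mul (a b : FreeAlgebra F G) :
    corner F X Y D (a * b) =
      FreeAlgebra.lift F X a * corner F X Y D b + corner F X Y D a * FreeAlgebra.lift F Y b := by
  rw [corner, map_mul, triangularHom_eq_fromBlocks, triangularHom_eq_fromBlocks,
    Matrix.fromBlocks_multiply, Matrix.toBlocks_fromBlocks₁₂]

theorem corner_add_right (D' : G → Matrix n n R) (r : FreeAlgebra F G) :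
    corner F X Y (D + D') r = corner F X Y D r + corner F X Y D' r := by
  induction r using FreeAlgebra.induction with
  | grade0 c => simp [corner_algebraMap]
  | grade1 g => simp [corner_ι]
  | add a b ha hb => simp only [corner_add, ha, hb]; abel
  | mul a b ha hb => simp only [corner_mul, ha, hb, Matrix.mul_add, Matrix.add_mul]; abel

theorem corner_smul_right (c : R) (r : FreeAlgebra F G) :
    corner F X Y (c • D) r = c • corner F X Y D r := by
  induction r using FreeAlgebra.induction with
  | grade0 c => simp [corner_algebraMap]
  | grade1 g => simp [corner_ι]
  | add a b ha hb => simp only [corner_add, ha, hb, smul_add]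
  | mul a b ha hb => simp only [corner_mul, ha, hb, Matrix.mul_smul, Matrix.smul_mul, smul_add]

theorem corner_commutator (f : Matrix n n R) (r : FreeAlgebra F G) :
    corner F X Y (fun g => X g * f - f * Y g) r =
      FreeAlgebra.lift F X r * f - f * FreeAlgebra.lift F Y r := by
  induction r using FreeAlgebra.induction with
  | grade0 c =>
    rw [corner_algebraMap, AlgHom.commutes, AlgHom.commutes, Algebra.algebraMap_eq_smul_one]
    simp
  | grade1 g => simp [corner_ι]
  | add a b ha hb => simp only [corner_add, ha, hb, map_add, Matrix.add_mul, Matrix.mul_add]; abel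
  | mul a b ha hb =>
    simp only [corner_mul, ha, hb, map_mul, Matrix.mul_sub, Matrix.sub_mul, Matrix.mul_assoc]; abel

theorem map_lift_matrix {R' : Type*} [CommRing R'] [Algebra F R'] (e : R →ₐ[F] R')
    (r : FreeAlgebra F G) :
    (FreeAlgebra.lift F X r).map e = FreeAlgebra.lift F (fun g => (X g).map e) r := by
  have h : e.mapMatrix.comp (FreeAlgebra.lift F X) = FreeAlgebra.lift F fun g => (X g).map e := by
    ext; simp
  exact DFunLike.congr_fun h r

theorem map_corner {R' : Type*} [CommRing R'] [Algebra F R'] (e : R →ₐ[F] R')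
    (r : FreeAlgebra F G) :
    (corner F X Y D r).map e =
      corner F (fun g => (X g).map e) (fun g => (Y g).map e) (fun g => (D g).map e) r := by
  have h := map_lift_matrix (fun g => Matrix.fromBlocks (X g) (D g) 0 (Y g)) e r
  simp only [Matrix.fromBlocks_map, Matrix.map_zero _ (map_zero e)] at h
  exact congrArg Matrix.toBlocks₁₂ h

/-- The coboundary `f ↦ X f - f Y`, in coordinates. -/
def coboundaryMap : (n × n → R) →ₗ[R] (G × n × n → R) where
  toFun f x := (X x.1 * Matrix.of (Function.curry f) - Matrix.of (Function.curry f) * Y x.1)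
    x.2.1 x.2.2
  map_add' f f' := by
    ext x
    have h : Matrix.of (Function.curry (f + f')) =
      Matrix.of (Function.curry f) + Matrix.of (Function.curry f') := rfl
    rw [h, Matrix.mul_add, Matrix.add_mul]
    simp only [Matrix.add_apply, Matrix.sub_apply, Pi.add_apply]
    ring
  map_smul' c f := by
    ext x
    have h : Matrix.of (Function.curry (c • f)) = c • Matrix.of (Function.curry f) := rfl
    rw [h, Matrix.mul_smul, Matrix.smul_mul, ← smul_sub]
    rfl

/-- Evaluation of derivations at an element of the free algebra, in coordinates. -/
def cornerMap (r : FreeAlgebra F G) : (G × n × n → R) →ₗ[R] (n × n → R) where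
  toFun D x := corner F X Y (fun g => Matrix.of fun i j => D (g, i, j)) r x.1 x.2
  map_add' D D' := by
    ext x
    exact congrFun (congrFun (corner_add_right X Y (fun g => Matrix.of fun i j => D (g, i, j))
      (fun g => Matrix.of fun i j => D' (g, i, j)) r) x.1) x.2
  map_smul' c D := by
    ext x
    exact congrFun (congrFun (corner_smul_right X Y (fun g => Matrix.of fun i j => D (g, i, j))
      c r) x.1) x.2

theorem comp_cornerMap {R' : Type*} [CommRing R'] [Algebra F R'] (e : R →ₐ[F] R')
    (r : FreeAlgebra F G) (D : G × n × n → R) :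
    e ∘ cornerMap X Y r D =
      cornerMap (fun g => (X g).map e) (fun g => (Y g).map e) r (e ∘ D) := by
  ext x
  exact congrFun (congrFun (map_corner X Y (fun g => Matrix.of fun i j => D (g, i, j)) e r) x.1) x.2

end Corner

theorem comp_coboundaryMap {R R' G n : Type*} [CommRing R] [CommRing R'] [Fintype n]
    (X Y : G → Matrix n n R) (e : R →+* R') (f : n × n → R) :
    e ∘ coboundaryMap X Y f =
      coboundaryMap (fun g => (X g).map e) (fun g => (Y g).map e) (e ∘ f) := by
  ext x
  simp [coboundaryMap, Matrix.mul_apply, Function.curry]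

theorem LinearMap.map_toMatrix' {R R' V W : Type*} [CommRing R] [CommRing R'] [Fintype V]
    [DecidableEq V] (e : R →+* R') (L : (V → R) →ₗ[R] (W → R)) (L' : (V → R') →ₗ[R'] (W → R'))
    (h : ∀ v, e ∘ L v = L' (e ∘ v)) :
    (LinearMap.toMatrix' L).map e = LinearMap.toMatrix' L' := by
  ext i j
  have h₁ : e ∘ (Pi.single j 1 : V → R) = Pi.single j 1 := by
    ext k
    by_cases hk : k = j <;> simp [hk]
  have h₂ := congrFun (h (Pi.single j 1)) i
  rw [h₁] at h₂
  simpa [LinearMap.toMatrix'_apply] using h₂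

/-- If `Ext¹` of the representation `Y` with itself vanishes, then the identity of `Y` deforms to
intertwiners from `Y` to nearby representations. -/
theorem exists_intertwiner_family {F R G n : Type*} [Field F] [CommRing R] [Algebra F R]
    [Fintype G] [DecidableEq G] [Fintype n] [DecidableEq n] (X : G → Matrix n n R)
    (Y : G → Matrix n n F) (e₀ : R →ₐ[F] F) (hXY : ∀ g, (X g).map e₀ = Y g)
    (J : Set (FreeAlgebra F G)) (hY : ∀ r ∈ J, FreeAlgebra.lift F Y r = 0)
    (hrigid : ∀ D : G → Matrix n n F, (∀ r ∈ J, corner F Y Y D r = 0) →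
      ∃ f, ∀ g, D g = Y g * f - f * Y g) :
    ∃ u : Matrix n n R, (∃ c : F, c ≠ 0 ∧ u.map e₀ = c • 1) ∧
      ∀ e : R →ₐ[F] F, (∀ r ∈ J, FreeAlgebra.lift F (fun g => (X g).map e) r = 0) →
        ∀ g, (X g).map e * u.map e = u.map e * Y g := by
  classical
  obtain ⟨t, htJ, ht⟩ := LinearMap.exists_finset_forall_eq_zero (cornerMap Y Y) J
  set Y' : G → Matrix n n R := fun g => (Y g).map (algebraMap F R)
  have hY' : ∀ e : R →ₐ[F] F, (fun g => (Y' g).map e) = Y := fun e => by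
    ext; simp [Y']
  set A := LinearMap.toMatrix' (coboundaryMap X Y')
  set B : Matrix (t × n × n) (G × n × n) R :=
    Matrix.of fun x y => LinearMap.toMatrix' (cornerMap X Y' x.1.1) x.2 y
  have hA : ∀ e : R →ₐ[F] F,
      A.map e = LinearMap.toMatrix' (coboundaryMap (fun g => (X g).map e) Y) := fun e => by
    refine LinearMap.map_toMatrix' (e : R →+* F) _ _ fun v => ?_
    rw [comp_coboundaryMap, ← hY' e]
    rfl
  have hB : ∀ (e : R →ₐ[F] F) w (r : t) x, (B.map e *ᵥ w) (r, x) =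
      cornerMap (fun g => (X g).map e) Y r.1 w x := fun e w r x => by
    rw [← LinearMap.toMatrix'_mulVec, ← LinearMap.map_toMatrix' (e : R →+* F)
      (cornerMap X Y' r.1) _ fun v => by rw [← hY' e]; exact comp_cornerMap X Y' e r.1 v]
    rfl
  have hX₀ : (fun g => (X g).map e₀) = Y := funext hXY
  obtain ⟨u, ⟨c, hc, hu₀⟩, hu⟩ := Matrix.exists_deformation_of_mulVec_eq_zero A B e₀
    (fun w hw => by
      have hw' := ht w fun r hr => by
        ext x
        have := hB e₀ w ⟨r, hr⟩ x
        rw [hw, hX₀] at this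
        exact this.symm
      obtain ⟨f, hf⟩ := hrigid (fun g => Matrix.of fun i j => w (g, i, j)) fun r hr => by
        ext i j
        exact congrFun (hw' r hr) (i, j)
      refine ⟨fun x => f x.1 x.2, ?_⟩
      rw [hA, LinearMap.toMatrix'_mulVec, hX₀]
      ext x
      exact (congrFun (congrFun (hf x.1) x.2.1) x.2.2).symm)
    (fun x => (1 : Matrix n n F) x.1 x.2) (by
      rw [hA, LinearMap.toMatrix'_mulVec, hX₀]
      ext x
      have h : Y x.1 * 1 - 1 * Y x.1 = 0 := by simp
      exact congrFun (congrFun h x.2.1) x.2.2)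
  refine ⟨Matrix.of (Function.curry u), ⟨c, hc, ?_⟩, fun e he g => ?_⟩
  · ext i j
    exact congrFun hu₀ (i, j)
  · have h := hu e (by
      apply Matrix.toLin'.injective
      refine LinearMap.ext fun v => funext fun x => ?_
      rw [Matrix.toLin'_apply, ← Matrix.mulVec_mulVec, hB, hA, LinearMap.toMatrix'_mulVec]
      have h₁ := corner_commutator (F := F) (fun g => (X g).map e) Y (Matrix.of (Function.curry v))
        x.1.1
      rw [he _ (htJ x.1.2), hY _ (htJ x.1.2), Matrix.zero_mul, Matrix.mul_zero, sub_zero] at h₁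
      rw [map_zero]
      exact congrFun (congrFun h₁ x.2.1) x.2.2)
    rw [hA, LinearMap.toMatrix'_mulVec] at h
    rw [← sub_eq_zero]
    ext i j
    exact congrFun h (g, i, j)

/-- The matrix representation afforded by a module with a chosen basis. -/
def actionMatrix {F A M n : Type*} [Field F] [Ring A] [Algebra F A] [AddCommGroup M] [Module F M]
    [Module A M] [IsScalarTower F A M] [Fintype n] [DecidableEq n] (b : Module.Basis n F M) :
    A →ₐ[F] Matrix n n F :=
  (LinearMap.toMatrixAlgEquiv b).toAlgHom.comp (Algebra.lsmul F F M)

theorem actionMatrix_mulVec {F A M n : Type*} [Field F] [Ring A] [Algebra F A] [AddCommGroup M]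
    [Module F M] [Module A M] [IsScalarTower F A M] [Fintype n] [DecidableEq n]
    (b : Module.Basis n F M) (a : A) (m : M) :
    actionMatrix b a *ᵥ b.equivFun m = b.equivFun (a • m) :=
  LinearMap.toMatrix_mulVec_repr b b (Algebra.lsmul F F M a) m

theorem actionMatrix_apply {F A M n : Type*} [Field F] [Ring A] [Algebra F A] [AddCommGroup M]
    [Module F M] [Module A M] [IsScalarTower F A M] [Fintype n] [DecidableEq n]
    (b : Module.Basis n F M) (a : A) (i j : n) :
    actionMatrix b a i j = b.repr (a • b j) i :=
  LinearMap.toMatrixAlgEquiv_apply b (Algebra.lsmul F F M a) i j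

/-- Derivations from an algebra to the endomorphisms of a rigid module are inner. -/
theorem RigidModule.exists_eq_commutator {F A M n G : Type} [Field F] [Ring A] [Algebra F A]
    [AddCommGroup M] [Module F M] [Module A M] [IsScalarTower F A M] [Fintype n] [DecidableEq n]
    (hM : RigidModule A M) (b : Module.Basis n F M) (π : FreeAlgebra F G →ₐ[F] A)
    (hπ : Function.Surjective π) (Y : G → Matrix n n F)
    (hY : ∀ g, Y g = actionMatrix b (π (FreeAlgebra.ι F g)))
    (D : G → Matrix n n F) (hD : ∀ r, π r = 0 → corner F Y Y D r = 0) :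
    ∃ f, ∀ g, D g = Y g * f - f * Y g := by
  have hlift : ∀ r, FreeAlgebra.lift F Y r = actionMatrix b (π r) := fun r => by
    have h : FreeAlgebra.lift F Y = (actionMatrix b).comp π := by ext1; ext1 g; simp [hY]
    rw [h]
    rfl
  have hker : RingHom.ker π.toRingHom ≤ RingHom.ker (triangularHom F Y Y D).toRingHom := by
    intro r hr
    have hr' : π r = 0 := hr
    change triangularHom F Y Y D r = 0
    rw [triangularHom_eq_fromBlocks, hD r hr', hlift, hr', map_zero, Matrix.fromBlocks_zero]
  set T : A →+* Matrix (n ⊕ n) (n ⊕ n) F :=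
    RingHom.liftOfSurjective π.toRingHom hπ ⟨(triangularHom F Y Y D).toRingHom, hker⟩
  have hT : ∀ r, T (π r) = triangularHom F Y Y D r := fun r =>
    RingHom.liftOfRightInverse_comp_apply _ _ _ ⟨(triangularHom F Y Y D).toRingHom, hker⟩ r
  let : Module A (n ⊕ n → F) := Module.compHom (n ⊕ n → F)
    ((Matrix.toLinAlgEquiv' (R := F) (n := n ⊕ n)).toAlgHom.toRingHom.comp T)
  have hsmul : ∀ (a : A) (v : n ⊕ n → F), a • v = T a *ᵥ v := fun _ _ => rfl
  have hblock : ∀ r (v : n ⊕ n → F), π r • v =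
      Sum.elim (actionMatrix b (π r) *ᵥ (v ∘ Sum.inl) + corner F Y Y D r *ᵥ (v ∘ Sum.inr))
        (actionMatrix b (π r) *ᵥ (v ∘ Sum.inr)) := fun r v => by
    rw [hsmul, hT, triangularHom_eq_fromBlocks, Matrix.fromBlocks_mulVec, hlift, Matrix.zero_mulVec,
      zero_add]
  let f : M →ₗ[A] (n ⊕ n → F) :=
    { toFun := fun m => Sum.elim (b.equivFun m) 0
      map_add' := fun m m' => by
        rw [map_add]
        ext (i | i) <;> simp
      map_smul' := fun a m => by
        obtain ⟨r, rfl⟩ := hπ a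
        rw [RingHom.id_apply, hblock, Sum.elim_comp_inl, Sum.elim_comp_inr, Matrix.mulVec_zero,
          add_zero, Matrix.mulVec_zero, actionMatrix_mulVec] }
  let g : (n ⊕ n → F) →ₗ[A] M :=
    { toFun := fun v => b.equivFun.symm (v ∘ Sum.inr)
      map_add' := fun v v' => by rw [← map_add]; rfl
      map_smul' := fun a v => by
        obtain ⟨r, rfl⟩ := hπ a
        rw [RingHom.id_apply, hblock, Sum.elim_comp_inr, LinearEquiv.symm_apply_eq,
          ← actionMatrix_mulVec, LinearEquiv.apply_symm_apply] }
  obtain ⟨s, hs⟩ := hM (n ⊕ n → F) f g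
    (fun m m' h => b.equivFun.injective (funext fun i => congrFun h (Sum.inl i)))
    (fun m => ⟨Sum.elim 0 (b.equivFun m), by
      change b.equivFun.symm (Sum.elim 0 (b.equivFun m) ∘ Sum.inr) = m
      rw [Sum.elim_comp_inr, LinearEquiv.symm_apply_apply]⟩)
    (by
      ext v
      rw [LinearMap.mem_ker]
      change (∃ m, Sum.elim (b.equivFun m) 0 = v) ↔ b.equivFun.symm (v ∘ Sum.inr) = 0
      rw [LinearEquiv.map_eq_zero_iff]
      constructor
      · rintro ⟨m, rfl⟩
        exact Sum.elim_comp_inr _ _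
      · intro h
        refine ⟨b.equivFun.symm (v ∘ Sum.inl), ?_⟩
        rw [LinearEquiv.apply_symm_apply, ← h, Sum.elim_comp_inl_inr])
  have hs₂ : ∀ m, s m ∘ Sum.inr = b.equivFun m := fun m => by
    rw [← LinearEquiv.symm_apply_eq]
    exact LinearMap.congr_fun hs m
  let σ : (n → F) →ₗ[F] (n → F) :=
    { toFun := fun v => s (b.equivFun.symm v) ∘ Sum.inl
      map_add' := fun v v' => by rw [map_add, map_add]; rfl
      map_smul' := fun c v => by
        rw [map_smul, ← algebraMap_smul A c, map_smul, ← π.commutes, hsmul, hT, AlgHom.commutes,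
          Algebra.algebraMap_eq_smul_one, Matrix.smul_mulVec, Matrix.one_mulVec]
        rfl }
  refine ⟨-LinearMap.toMatrix' σ, fun g => ?_⟩
  have key : LinearMap.toMatrix' σ * Y g = Y g * LinearMap.toMatrix' σ + D g := by
    apply Matrix.toLin'.injective
    refine LinearMap.ext fun v => ?_
    obtain ⟨m, rfl⟩ := b.equivFun.surjective v
    have h := congrArg (· ∘ Sum.inl) (s.map_smul (π (FreeAlgebra.ι F g)) m)
    simp only [hblock, Sum.elim_comp_inl, corner_ι, hs₂] at h
    simp only [Matrix.toLin'_apply, Matrix.add_mulVec, ← Matrix.mulVec_mulVec, hY,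
      actionMatrix_mulVec, LinearMap.toMatrix'_mulVec]
    change s (b.equivFun.symm _) ∘ Sum.inl = _ *ᵥ (s (b.equivFun.symm _) ∘ Sum.inl) + _
    rw [LinearEquiv.symm_apply_apply, LinearEquiv.symm_apply_apply, h]
  rw [Matrix.mul_neg, Matrix.neg_mul, key]
  abel

/-- Orthogonal idempotents summing to one admit a common eigenbasis. -/
theorem exists_basis_of_orthogonal_idempotents {F M I : Type*} [Field F] [AddCommGroup M]
    [Module F M] [Module.Finite F M] [Fintype I] [DecidableEq I] (p : I → M →ₗ[F] M)
    (hidem : ∀ i m, p i (p i m) = p i m) (horth : ∀ i j, i ≠ j → ∀ m, p i (p j m) = 0)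
    (hsum : ∀ m, ∑ i, p i m = m) (d : I → ℕ)
    (hd : ∀ i, Module.finrank F (LinearMap.range (p i)) = d i) :
    ∃ b : Module.Basis ((i : I) × Fin (d i)) F M,
      ∀ i x, p i (b x) = if x.1 = i then b x else 0 := by
  have hmem : ∀ i j (w : LinearMap.range (p j)), p i w = if j = i then (w : M) else 0 := by
    rintro i j ⟨_, m, rfl⟩
    split_ifs with h
    · rw [h, hidem]
    · exact horth i j (Ne.symm h) m
  let φ : M ≃ₗ[F] ((i : I) → LinearMap.range (p i)) :=
    { toFun := fun m i => ⟨p i m, m, rfl⟩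
      invFun := fun v => ∑ i, (v i : M)
      map_add' := fun m m' => by ext i; simp
      map_smul' := fun c m => by ext i; simp
      left_inv := hsum
      right_inv := fun v => by
        ext i
        simp [map_sum, hmem] }
  refine ⟨(Pi.basis fun i => Module.finBasisOfFinrankEq F _ (hd i)).map φ.symm, fun i x => ?_⟩
  have hb : ∀ v : (i : I) → LinearMap.range (p i), φ.symm v = ∑ i, (v i : M) := fun _ => rfl
  obtain ⟨j, k⟩ := x
  have hval : φ.symm (Pi.single j (Module.finBasisOfFinrankEq F _ (hd j) k)) =
      (Module.finBasisOfFinrankEq F _ (hd j) k : M) := by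
    rw [hb, Finset.sum_eq_single j]
    · simp
    · intro l _ hl
      simp [hl]
    · simp
  rw [Module.Basis.map_apply, Pi.basis_apply, hval, hmem]

/-- The projection of `⊕ᵢ R^{dᵢ}` onto the summand at the vertex `i`. -/
def vertexMatrix (R : Type*) [CommRing R] {Q : FinQuiver} (d : Q.V → ℕ) (i : Q.V) :
    Matrix (RepIx Q d) (RepIx Q d) R :=
  Matrix.diagonal fun x => if x.1 = i then 1 else 0

/-- The matrices by which the generators of the path algebra act on the representation `X`. -/
def generatorMatrix {R : Type*} [CommRing R] {Q : FinQuiver} {d : Q.V → ℕ}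
    (X : Q.A → Matrix (RepIx Q d) (RepIx Q d) R) : Q.V ⊕ Q.A → Matrix (RepIx Q d) (RepIx Q d) R :=
  Sum.elim (vertexMatrix R d) X

variable {K Q}

theorem BlockCompatible.vertexMatrix_mul {d : Q.V → ℕ} {X : RepSpace K Q d}
    (hX : BlockCompatible K Q d X) (a : Q.A) : vertexMatrix K d (Q.tgt a) * X a = X a := by
  ext u v
  rw [vertexMatrix, Matrix.diagonal_mul]
  by_cases h : X a u v = 0
  · simp [h]
  · simp [(hX a u v h).1]

theorem BlockCompatible.mul_vertexMatrix {d : Q.V → ℕ} {X : RepSpace K Q d}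
    (hX : BlockCompatible K Q d X) (a : Q.A) : X a * vertexMatrix K d (Q.src a) = X a := by
  ext u v
  rw [vertexMatrix, Matrix.mul_diagonal]
  by_cases h : X a u v = 0
  · simp [h]
  · simp [(hX a u v h).2]

/-- An arrow-wise block compatible tuple of matrices defines a representation of the path
algebra. -/
theorem BlockCompatible.lift_generatorMatrix_rel {d : Q.V → ℕ} {X : RepSpace K Q d}
    (hX : BlockCompatible K Q d X) {x y : FreeAlgebra K (Q.V ⊕ Q.A)} (h : PathRel K Q x y) :
    FreeAlgebra.lift K (generatorMatrix X) x = FreeAlgebra.lift K (generatorMatrix X) y := by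
  cases h with
  | idem i => simp [generatorMatrix, vertexMatrix]
  | orth i j h =>
    simp only [map_mul, FreeAlgebra.lift_ι_apply, generatorMatrix, Sum.elim_inl, vertexMatrix,
      Matrix.diagonal_mul_diagonal, map_zero]
    rw [← Matrix.diagonal_zero]
    congr 1
    ext x
    by_cases hx : x.1 = i <;> simp [hx, h]
  | sum_one =>
    simp only [map_sum, FreeAlgebra.lift_ι_apply, generatorMatrix, Sum.elim_inl, vertexMatrix,
      map_one]
    ext u v
    rw [Matrix.sum_apply]
    by_cases huv : u = v
    · subst huv; simp
    · simp [huv]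
  | tgt_mul a => simpa [generatorMatrix] using hX.vertexMatrix_mul a
  | mul_src a => simpa [generatorMatrix] using hX.mul_vertexMatrix a

theorem map_relElem {B : Type*} [Ring B] [Algebra K B] (ψ : PathAlgebra K Q →ₐ[K] B)
    (c : QPath Q →₀ K) : ψ (relElem K Q c) =
      c.sum fun p l => l • (p.arrows.map fun a => ψ (arrowElem K Q a)).prod := by
  simp [relElem, pathElem, Finsupp.sum, map_list_prod, Function.comp_def]

/-- The points of the representation variety are representations of `KQ` annihilated by the
kernel of the presentation. -/
theorem lift_generatorMatrix_eq_zero {A : Type} [Ring A] [Algebra K A]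
    {φ : PathAlgebra K Q →ₐ[K] A} (hφ : IsAdmissiblePresentation K Q φ) {d : Q.V → ℕ}
    {X : RepSpace K Q d} (hX : X ∈ RepSet K Q φ d) (r : FreeAlgebra K (Q.V ⊕ Q.A))
    (hr : φ (RingQuot.mkAlgHom K (PathRel K Q) r) = 0) :
    FreeAlgebra.lift K (generatorMatrix X) r = 0 := by
  obtain ⟨hblock, hrel⟩ := hX
  obtain ⟨-, ⟨S, hS, hspan⟩, -⟩ := hφ
  set ψ : PathAlgebra K Q →ₐ[K] Matrix (RepIx Q d) (RepIx Q d) K :=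
    RingQuot.liftAlgHom K ⟨FreeAlgebra.lift K (generatorMatrix X),
      fun _ _ => hblock.lift_generatorMatrix_rel⟩
  have hψ : ∀ r, ψ (RingQuot.mkAlgHom K (PathRel K Q) r) =
      FreeAlgebra.lift K (generatorMatrix X) r := fun r =>
    RingQuot.liftAlgHom_mkAlgHom_apply K _ _ r
  have hS' : ∀ s ∈ S, ψ s = 0 := by
    intro s hs
    obtain ⟨c, i, j, hc, rfl⟩ := hS s hs
    have hker : φ (relElem K Q c) = 0 := by
      have hmem : relElem K Q c ∈ twoSidedSpan (PathAlgebra K Q) S :=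
        AddSubgroup.subset_closure ⟨1, 1, _, hs, by simp⟩
      rwa [hspan] at hmem
    rw [map_relElem, ← hrel c i j hc hker]
    simp [relEval, pathProd, arrowElem, hψ, generatorMatrix]
  have hmem : RingQuot.mkAlgHom K (PathRel K Q) r ∈
      AddSubgroup.closure {x | ∃ a b : PathAlgebra K Q, ∃ s ∈ S, x = a * s * b} := by
    change _ ∈ twoSidedSpan (PathAlgebra K Q) S
    rw [hspan]
    exact hr
  rw [← hψ]
  generalize RingQuot.mkAlgHom K (PathRel K Q) r = y at hmem ⊢
  induction hmem using AddSubgroup.closure_induction with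
  | mem x hx =>
    obtain ⟨a, b, s, hs, rfl⟩ := hx
    rw [map_mul, map_mul, hS' s hs, mul_zero, zero_mul]
  | zero => exact map_zero ψ
  | add x y _ _ hx hy => rw [map_add, hx, hy, add_zero]
  | neg x _ hx => rw [map_neg, hx, neg_zero]

/-- A finite-dimensional module is given by a point of the representation variety of its dimension
vector. -/
theorem exists_basis_mem_repSet {A : Type} [Ring A] [Algebra K A] (φ : PathAlgebra K Q →ₐ[K] A)
    (M : Type) [AddCommGroup M] [Module K M] [Module A M] [IsScalarTower K A M]
    [Module.Finite K M] (d : Q.V → ℕ) (hd : dimVec K Q φ M = d) :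
    ∃ (b : Module.Basis (RepIx Q d) K M) (Y : RepSpace K Q d), Y ∈ RepSet K Q φ d ∧
      ∀ g, generatorMatrix Y g =
        actionMatrix b (φ (RingQuot.mkAlgHom K (PathRel K Q) (FreeAlgebra.ι K g))) := by
  have hrel : ∀ {x y}, PathRel K Q x y → RingQuot.mkAlgHom K (PathRel K Q) x =
      RingQuot.mkAlgHom K (PathRel K Q) y := RingQuot.mkAlgHom_rel K
  obtain ⟨b, hb⟩ := exists_basis_of_orthogonal_idempotents
    (fun i => actionMap K A M (φ (vertexElem K Q i)))
    (fun i m => by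
      change φ _ • φ _ • m = φ _ • m
      rw [← mul_smul, ← map_mul, vertexElem, ← map_mul, hrel (.idem i)])
    (fun i j hij m => by
      change φ _ • φ _ • m = 0
      rw [← mul_smul, ← map_mul, vertexElem, vertexElem, ← map_mul, hrel (.orth i j hij),
        map_zero, map_zero, zero_smul])
    (fun m => by
      change ∑ i, φ (vertexElem K Q i) • m = m
      simp only [← Finset.sum_smul, ← map_sum, vertexElem]
      rw [hrel .sum_one, map_one, map_one, one_smul])
    d (fun i => congrFun hd i)
  have hvertex : ∀ i, actionMatrix b (φ (vertexElem K Q i)) = vertexMatrix K d i := fun i => by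
    ext u v
    have h : φ (vertexElem K Q i) • b v = if v.1 = i then b v else 0 := hb i v
    rw [actionMatrix_apply, h, vertexMatrix, Matrix.diagonal_apply]
    by_cases huv : u = v
    · subst huv
      by_cases hi : u.1 = i <;> simp [hi]
    · by_cases hi : v.1 = i <;> simp [hi, huv]
  refine ⟨b, fun a => actionMatrix b (φ (arrowElem K Q a)), ⟨fun a u v h => ?_, ?_⟩, ?_⟩
  · have htgt : vertexMatrix K d (Q.tgt a) * actionMatrix b (φ (arrowElem K Q a)) =
        actionMatrix b (φ (arrowElem K Q a)) := by
      rw [← hvertex, ← map_mul, ← map_mul, arrowElem, vertexElem, ← map_mul, hrel (.tgt_mul a)]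
    have hsrc : actionMatrix b (φ (arrowElem K Q a)) * vertexMatrix K d (Q.src a) =
        actionMatrix b (φ (arrowElem K Q a)) := by
      rw [← hvertex, ← map_mul, ← map_mul, arrowElem, vertexElem, ← map_mul, hrel (.mul_src a)]
    constructor
    · by_contra hne
      refine h ?_
      change actionMatrix b (φ (arrowElem K Q a)) u v = 0
      rw [← htgt, vertexMatrix, Matrix.diagonal_mul]
      simp [hne]
    · by_contra hne
      refine h ?_
      change actionMatrix b (φ (arrowElem K Q a)) u v = 0
      rw [← hsrc, vertexMatrix, Matrix.mul_diagonal]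
      simp [hne]
  · intro c i j _ hc
    have h := map_relElem ((actionMatrix b).comp φ) c
    rw [AlgHom.comp_apply, hc, map_zero] at h
    exact h.symm
  · rintro (i | a)
    · exact (hvertex i).symm
    · rfl

/-- The isomorphism class of a rigid module contains a non-empty basic open subset of the
representation variety. -/
theorem RigidModule.exists_basic_open {A : Type} [Ring A] [Algebra K A]
    {φ : PathAlgebra K Q →ₐ[K] A} (hφ : IsAdmissiblePresentation K Q φ)
    {M : Type} [AddCommGroup M] [Module K M] [Module A M] [IsScalarTower K A M]
    (hM : RigidModule A M) {d : Q.V → ℕ} (b : Module.Basis (RepIx Q d) K M) {Y : RepSpace K Q d}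
    (hYmem : Y ∈ RepSet K Q φ d)
    (hY : ∀ g, generatorMatrix Y g =
      actionMatrix b (φ (RingQuot.mkAlgHom K (PathRel K Q) (FreeAlgebra.ι K g)))) :
    ∃ U : Set (RepSpace K Q d), @IsOpen _ (repTopology K Q d) U ∧ Y ∈ U ∧
      ∀ X ∈ RepSet K Q φ d, X ∈ U → ∃ f : (M ≃ₗ[K] (RepIx Q d → K)), ∀ g m,
        f (φ (RingQuot.mkAlgHom K (PathRel K Q) (FreeAlgebra.ι K g)) • m) =
          generatorMatrix X g *ᵥ f m := by
  set e : RepSpace K Q d → (MvPolynomial (Q.A × RepIx Q d × RepIx Q d) K →ₐ[K] K) :=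
    fun X => MvPolynomial.aeval fun x => X x.1 x.2.1 x.2.2
  set X₀ : Q.A → Matrix (RepIx Q d) (RepIx Q d) (MvPolynomial (Q.A × RepIx Q d × RepIx Q d) K) :=
    fun a => Matrix.of fun i j => MvPolynomial.X (a, i, j)
  have he : ∀ X g, (generatorMatrix X₀ g).map (e X) = generatorMatrix X g := by
    rintro X (i | a)
    · simp [generatorMatrix, vertexMatrix, Matrix.diagonal_map, apply_ite]
    · ext u v
      simp [generatorMatrix, X₀, e]
  obtain ⟨u, ⟨c, hc, hu₀⟩, hu⟩ := exists_intertwiner_family (generatorMatrix X₀) (generatorMatrix Y)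
    (e Y) (he Y) {r | φ (RingQuot.mkAlgHom K (PathRel K Q) r) = 0}
    (fun r hr => lift_generatorMatrix_eq_zero hφ hYmem r hr)
    (fun D hD => hM.exists_eq_commutator b (φ.comp (RingQuot.mkAlgHom K (PathRel K Q)))
      (hφ.1.comp (RingQuot.mkAlgHom_surjective K _)) _ hY D hD)
  have hdet : ∀ X, MvPolynomial.eval (fun x => X x.1 x.2.1 x.2.2) u.det = (u.map (e X)).det :=
    fun X => (e X).map_det u
  refine ⟨{X | MvPolynomial.eval (fun x => X x.1 x.2.1 x.2.2) u.det ≠ 0}, ?_, ?_, ?_⟩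
  · exact ⟨_, TopologicalSpace.isOpen_generateFrom_of_mem ⟨u.det, rfl⟩, rfl⟩
  · rw [Set.mem_ofPred_eq, hdet, hu₀]
    simp [hc]
  · intro X hX hXU
    rw [Set.mem_ofPred_eq, hdet] at hXU
    have hint := hu (e X) (fun r hr => by
      simpa only [he] using lift_generatorMatrix_eq_zero hφ hX r hr)
    refine ⟨b.equivFun ≪≫ₗ Matrix.toLinearEquiv' (u.map (e X))
      ((Matrix.isUnit_iff_isUnit_det _).2 hXU.isUnit).invertible, fun g m => ?_⟩
    change u.map (e X) *ᵥ b.equivFun _ = _ *ᵥ (u.map (e X) *ᵥ b.equivFun m)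
    rw [← actionMatrix_mulVec, ← hY, Matrix.mulVec_mulVec, ← hint g, he, Matrix.mulVec_mulVec]

end GeometricIrreducibility

/-- Let `A = KQ/I` be a finite-dimensional algebra over an algebraically
closed field `K` (with `I` admissible), and assume `A` is geometrically irreducible.
If `M` and `N` are rigid finite-dimensional `A`-modules (i.e. `Ext¹_A(M,M) = 0` and
`Ext¹_A(N,N) = 0`) with the same dimension vector, then `M` and `N` are isomorphic. -/
theorem rigid_modules_with_same_dimVec_are_iso [IsAlgClosed K]
    (A : Type) [Ring A] [Algebra K A] [Module.Finite K A]
    (φ : PathAlgebra K Q →ₐ[K] A) (hadm : IsAdmissiblePresentation K Q φ)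
    (hirr : IsGeomIrreducible K Q φ)
    (M : Type) [AddCommGroup M] [Module K M] [Module A M] [IsScalarTower K A M]
    [Module.Finite K M]
    (N : Type) [AddCommGroup N] [Module K N] [Module A N] [IsScalarTower K A N]
    [Module.Finite K N]
    (hM : RigidModule A M) (hN : RigidModule A N)
    (hdim : dimVec K Q φ M = dimVec K Q φ N) :
    Nonempty (M ≃ₗ[A] N) := by
  obtain ⟨bM, Y, hY, hYM⟩ := exists_basis_mem_repSet φ M _ rfl
  obtain ⟨bN, Z, hZ, hZN⟩ := exists_basis_mem_repSet φ N _ hdim.symm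
  obtain ⟨U, hU, hYU, hUM⟩ := hM.exists_basic_open hadm bM hY hYM
  obtain ⟨V, hV, hZV, hVN⟩ := hN.exists_basic_open hadm bN hZ hZN
  obtain ⟨X, hX, hXU, hXV⟩ := (hirr (dimVec K Q φ M)).2 U V hU hV ⟨Y, hY, hYU⟩ ⟨Z, hZ, hZV⟩
  obtain ⟨f, hf⟩ := hUM X hX hXU
  obtain ⟨f', hf'⟩ := hVN X hX hXV
  have hlin : ∀ (r : FreeAlgebra K (Q.V ⊕ Q.A)) (m : M),
      (f ≪≫ₗ f'.symm) (φ (RingQuot.mkAlgHom K (PathRel K Q) r) • m) =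
        φ (RingQuot.mkAlgHom K (PathRel K Q) r) • (f ≪≫ₗ f'.symm) m := by
    intro r
    induction r using FreeAlgebra.induction with
    | grade0 c => intro m; rw [AlgHom.commutes, AlgHom.commutes, algebraMap_smul, algebraMap_smul,
        map_smul]
    | grade1 g => intro m; simp [LinearEquiv.symm_apply_eq, hf, hf']
    | add r s hr hs => intro m; simp only [map_add, add_smul, hr, hs]
    | mul r s hr hs => intro m; rw [map_mul, map_mul, mul_smul, hr, hs, mul_smul]
  refine ⟨{ f ≪≫ₗ f'.symm with map_smul' := fun a m => ?_ }⟩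
  obtain ⟨x, rfl⟩ := hadm.1 a
  obtain ⟨r, rfl⟩ := RingQuot.mkAlgHom_surjective K (PathRel K Q) x
  exact hlin r m

end
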